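/- For all α ∈ (0,1), b ∈ [0,∞) and T ∈ [0,∞) there exists a constant K = K(α,b,T) ∈ [0,∞) with the following property: for every a ∈ [0,∞) and every Lebesgue-integrable function φ : [0,T] → [0,∞) satisfying φ(t) ≤ a + b·∫_0^t φ(s)·(t−s)^{−α} ds for all t ∈ [0,T], one has φ(t) ≤ a·K for all t ∈ [0,T]. -/

import Mathlib

open MeasureTheory

/-- A convolution inequality `F ≤ A + F ⋆ κ` with an integrable `F` and a kernel `κ` of mass at
most `1/2` forces the pointwise bound `F ≤ 2 A`. -/
theorem le_two_mul_of_le_add_lintegral_convolution {κ F : ℝ → ENNReal} {A : ENNReal}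
    (hκ : Measurable κ) (hκ_mass : ∫⁻ r, κ r ≤ 2⁻¹) (hF : AEMeasurable F)
    (hF_fin : ∫⁻ s, F s ≠ ⊤) (h : ∀ t, F t ≤ A + ∫⁻ s, F s * κ (t - s)) (t : ℝ) :
    F t ≤ 2 * A := by
  set g : ℝ → ENNReal := fun s => F s - 2 * A with hg_def
  have hg : AEMeasurable g := hF.sub_const _
  have hg_le (t : ℝ) : g t ≤ ∫⁻ s, g s * κ (t - s) := by
    have hκ_sub : Measurable fun s => κ (t - s) := by fun_prop
    have hconst : ∫⁻ s, 2 * A * κ (t - s) ≤ A := by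
      rw [lintegral_const_mul _ hκ_sub, lintegral_sub_left_eq_self κ t]
      calc 2 * A * ∫⁻ r, κ r ≤ 2 * A * 2⁻¹ := by gcongr
        _ = A := by
          rw [mul_right_comm, ENNReal.mul_inv_cancel two_ne_zero ENNReal.ofNat_ne_top, one_mul]
    rw [hg_def]
    refine tsub_le_iff_left.mpr ?_
    calc F t ≤ A + ∫⁻ s, F s * κ (t - s) := h t
      _ ≤ A + ∫⁻ s, (g s * κ (t - s) + 2 * A * κ (t - s)) := by
          gcongr with s
          rw [← add_mul]
          gcongr
          exact le_tsub_add
      _ = A + ((∫⁻ s, g s * κ (t - s)) + ∫⁻ s, 2 * A * κ (t - s)) := by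
          rw [lintegral_add_right _ (hκ_sub.const_mul _)]
      _ ≤ A + ((∫⁻ s, g s * κ (t - s)) + A) := by gcongr
      _ = 2 * A + ∫⁻ s, g s * κ (t - s) := by ring
  have hg_fin : ∫⁻ s, g s ≠ ⊤ :=
    ne_top_of_le_ne_top hF_fin (lintegral_mono fun s => tsub_le_self)
  have hg_half : ∫⁻ s, g s ≤ (∫⁻ s, g s) * 2⁻¹ :=
    calc ∫⁻ t, g t ≤ ∫⁻ t, ∫⁻ s, g s * κ (t - s) := lintegral_mono hg_le
      _ = ∫⁻ s, ∫⁻ t, g s * κ (t - s) :=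
          lintegral_lintegral_swap
            (hg.comp_snd.mul (hκ.comp (measurable_fst.sub measurable_snd)).aemeasurable)
      _ = ∫⁻ s, g s * ∫⁻ r, κ r := by
          congr with s
          rw [lintegral_const_mul _ (by fun_prop : Measurable fun t => κ (t - s)),
            lintegral_sub_right_eq_self κ s]
      _ = (∫⁻ s, g s) * ∫⁻ r, κ r := lintegral_mul_const'' _ hg
      _ ≤ (∫⁻ s, g s) * 2⁻¹ := by gcongr
  have hg_zero : ∫⁻ s, g s = 0 := by
    by_contra hne
    rw [← div_eq_mul_inv] at hg_half
    exact (ENNReal.half_lt_self hne hg_fin).not_ge hg_half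
  have hg_ae : g =ᵐ[volume] 0 := (lintegral_eq_zero_iff' hg).mp hg_zero
  have hgt : g t ≤ 0 := (hg_le t).trans_eq <| by
    rw [lintegral_congr_ae (g := 0) (hg_ae.mono fun s hs => by simp [hs])]
    simp
  exact tsub_eq_zero_iff_le.mp (nonpos_iff_eq_zero.mp hgt)

/-- The exponentially damped singular kernel has arbitrarily small mass. -/
theorem exists_lintegral_rpow_mul_exp_le_half {α b : ℝ} (hα : α < 1) (hb : 0 ≤ b) :
    ∃ l : ℝ, 0 < l ∧
      ∫⁻ r in Set.Ici (0 : ℝ), ‖b * (r ^ (-α) * Real.exp (-(l * r)))‖ₑ ≤ 2⁻¹ := by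
  have hβ : 0 < 1 - α := by linarith
  have hΓ : 0 < Real.Gamma (1 - α) := Real.Gamma_pos_of_pos hβ
  set c : ℝ := 2 * (b * Real.Gamma (1 - α)) + 1 with hc_def
  have hc : 0 < c := by positivity
  have hl : 0 < c ^ (1 - α)⁻¹ := by positivity
  refine ⟨c ^ (1 - α)⁻¹, hl, ?_⟩
  set l : ℝ := c ^ (1 - α)⁻¹
  have hint : ∫ r in Set.Ioi (0 : ℝ), r ^ (-α) * Real.exp (-(l * r))
      = c⁻¹ * Real.Gamma (1 - α) := by
    have := Real.integral_rpow_mul_exp_neg_mul_Ioi hβ hl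
    rw [sub_sub_cancel_left] at this
    rw [this, one_div, Real.inv_rpow hl.le, Real.rpow_inv_rpow hc.le hβ.ne']
  have hintegrable : IntegrableOn (fun r : ℝ => r ^ (-α) * Real.exp (-(l * r))) (Set.Ioi 0) :=
    Integrable.of_integral_ne_zero (by rw [hint]; positivity)
  have hnonneg : ∀ᵐ r ∂volume.restrict (Set.Ioi (0 : ℝ)),
      0 ≤ b * (r ^ (-α) * Real.exp (-(l * r))) := by
    filter_upwards [ae_restrict_mem measurableSet_Ioi] with r hr
    have : 0 < r := hr
    positivity
  rw [setLIntegral_congr Ioi_ae_eq_Ici.symm,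
    lintegral_congr_ae (hnonneg.mono fun r hr => Real.enorm_eq_ofReal hr),
    ← ofReal_integral_eq_lintegral_ofReal (hintegrable.const_mul b) hnonneg,
    integral_const_mul, hint, ← ENNReal.ofReal_ofNat, ← ENNReal.ofReal_inv_of_pos two_pos]
  apply ENNReal.ofReal_le_ofReal
  rw [show b * (c⁻¹ * Real.Gamma (1 - α)) = b * Real.Gamma (1 - α) / c by ring,
    div_le_iff₀ hc]
  linarith

/-- Extended Gronwall lemma with weakly singular kernel: for all `α ∈ (0,1)`, `b ≥ 0`,
`T ≥ 0` there is a constant `K = K(α,b,T) ≥ 0` such that every integrable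
`φ : [0,T] → [0,∞)` satisfying `φ(t) ≤ a + b ∫_0^t φ(s)(t-s)^{-α} ds` for all `t ∈ [0,T]`
also satisfies `φ(t) ≤ a K` for all `t ∈ [0,T]`. -/
theorem extended_gronwall (α b T : ℝ) (hα : α ∈ Set.Ioo (0 : ℝ) 1)
    (hb : 0 ≤ b) (hT : 0 ≤ T) :
    ∃ K : ℝ, 0 ≤ K ∧ ∀ a : ℝ, 0 ≤ a → ∀ φ : ℝ → ℝ,
      IntegrableOn φ (Set.Icc (0 : ℝ) T) →
      (∀ t ∈ Set.Icc (0 : ℝ) T, 0 ≤ φ t) →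
      (∀ t ∈ Set.Icc (0 : ℝ) T, φ t ≤ a + b * ∫ s in (0 : ℝ)..t, φ s * (t - s) ^ (-α)) →
      ∀ t ∈ Set.Icc (0 : ℝ) T, φ t ≤ a * K := by
  obtain ⟨l, hl, hmass⟩ := exists_lintegral_rpow_mul_exp_le_half hα.2 hb
  refine ⟨2 * Real.exp (l * T), by positivity, fun a ha φ hφ hφ_nonneg hle t ht => ?_⟩
  set κ : ℝ → ENNReal :=
    (Set.Ici (0 : ℝ)).indicator fun r => ‖b * (r ^ (-α) * Real.exp (-(l * r)))‖ₑ with hκ_def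
  set ψ : ℝ → ℝ := fun s => Real.exp (-(l * s)) * φ s with hψ_def
  set F : ℝ → ENNReal := (Set.Icc (0 : ℝ) T).indicator fun s => ‖ψ s‖ₑ with hF_def
  have hκ : Measurable κ := Measurable.indicator (by fun_prop) measurableSet_Ici
  have hψ : IntegrableOn ψ (Set.Icc 0 T) :=
    hφ.continuousOn_mul (by fun_prop) isCompact_Icc
  have hF : AEMeasurable F :=
    (aemeasurable_indicator_iff measurableSet_Icc).mpr hψ.aestronglyMeasurable.enorm
  have hF_fin : ∫⁻ s, F s ≠ ⊤ := by
    rw [hF_def, lintegral_indicator measurableSet_Icc]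
    exact hψ.hasFiniteIntegral.ne
  have hconv (u : ℝ) : F u ≤ ENNReal.ofReal a + ∫⁻ s, F s * κ (u - s) := by
    by_cases hu : u ∈ Set.Icc 0 T
    · have hfactor : Real.exp (-(l * u)) * (b * ∫ s in (0 : ℝ)..u, φ s * (u - s) ^ (-α))
          = ∫ s in Set.Ioc 0 u, ψ s * (b * ((u - s) ^ (-α) * Real.exp (-(l * (u - s))))) := by
        rw [intervalIntegral.integral_of_le hu.1, ← integral_const_mul, ← integral_const_mul]
        congr with s
        rw [hψ_def, show -(l * u) = -(l * s) + -(l * (u - s)) by ring, Real.exp_add]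
        ring
      have hexp : Real.exp (-(l * u)) ≤ 1 :=
        Real.exp_le_one_iff.mpr (neg_nonpos.mpr (mul_nonneg hl.le hu.1))
      have hψ_le : ψ u ≤ a
          + ∫ s in Set.Ioc 0 u, ψ s * (b * ((u - s) ^ (-α) * Real.exp (-(l * (u - s))))) := by
        rw [← hfactor]
        have := mul_le_mul_of_nonneg_left (hle u hu) (Real.exp_pos (-(l * u))).le
        rw [mul_add] at this
        exact this.trans (add_le_add_left (mul_le_of_le_one_left ha hexp) _)
      calc F u = ENNReal.ofReal (ψ u) := by
            rw [hF_def, Set.indicator_of_mem hu,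
              Real.enorm_eq_ofReal (mul_nonneg (Real.exp_pos _).le (hφ_nonneg u hu))]
        _ ≤ ENNReal.ofReal a + ENNReal.ofReal
              (∫ s in Set.Ioc 0 u, ψ s * (b * ((u - s) ^ (-α) * Real.exp (-(l * (u - s)))))) :=
            (ENNReal.ofReal_le_ofReal hψ_le).trans ENNReal.ofReal_add_le
        _ ≤ ENNReal.ofReal a + ∫⁻ s in Set.Ioc 0 u,
              ‖ψ s * (b * ((u - s) ^ (-α) * Real.exp (-(l * (u - s)))))‖ₑ := by
            gcongr
            exact (Real.ofReal_le_enorm _).trans (enorm_integral_le_lintegral_enorm _)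
        _ = ENNReal.ofReal a + ∫⁻ s in Set.Ioc 0 u, F s * κ (u - s) := by
            congr 1
            refine setLIntegral_congr_fun measurableSet_Ioc fun s hs => ?_
            have hsT : s ∈ Set.Icc 0 T := ⟨hs.1.le, hs.2.trans hu.2⟩
            rw [hF_def, hκ_def, Set.indicator_of_mem hsT,
              Set.indicator_of_mem (Set.mem_Ici.mpr (sub_nonneg.mpr hs.2)), enorm_mul]
        _ ≤ ENNReal.ofReal a + ∫⁻ s, F s * κ (u - s) := by
            gcongr
            exact Measure.restrict_le_self
    · rw [hF_def, Set.indicator_of_notMem hu]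
      exact zero_le
  have hbound := le_two_mul_of_le_add_lintegral_convolution hκ
    (by rwa [hκ_def, lintegral_indicator measurableSet_Ici]) hF hF_fin hconv t
  rw [hF_def, Set.indicator_of_mem ht,
    Real.enorm_eq_ofReal (mul_nonneg (Real.exp_pos _).le (hφ_nonneg t ht)),
    ← ENNReal.ofReal_ofNat, ← ENNReal.ofReal_mul zero_le_two,
    ENNReal.ofReal_le_ofReal_iff (by positivity)] at hbound
  calc φ t = Real.exp (l * t) * ψ t := by
        rw [hψ_def, ← mul_assoc, ← Real.exp_add, add_neg_cancel, Real.exp_zero, one_mul]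
    _ ≤ Real.exp (l * T) * (2 * a) := by
        exact mul_le_mul (Real.exp_le_exp.mpr (mul_le_mul_of_nonneg_left ht.2 hl.le)) hbound
          (mul_nonneg (Real.exp_pos _).le (hφ_nonneg t ht)) (Real.exp_pos _).le
    _ = a * (2 * Real.exp (l * T)) := by ring
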